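/- Let L be a G-graded field with graded subfields l and K, and let k be a graded subfield with k ⊆ l ∩ K. Then the restriction map ψ_{L/l,K/k} : P_{L/l} → P_{K/k}, sending O to O ∩ K, is surjective if and only if l and K are in general position with respect to k, i.e. every family of homogeneous elements of l^× that is algebraically independent over k is algebraically independent over K. -/

import Mathlib

universe u v

/-- A `G`-graded commutative ring structure on `A`: graded pieces `deg g`,
multiplicativity of the grading, and an internal direct sum decomposition
recorded by the homogeneous-component function `comp`. -/
structure GradedStr (G : Type u) [CommGroup G] (A : Type v) [CommRing A] where
  deg : G → AddSubgroup A
  one_mem : (1 : A) ∈ deg 1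
  mul_mem : ∀ {g h : G} {a b : A}, a ∈ deg g → b ∈ deg h → a * b ∈ deg (g * h)
  comp : A → G → A
  comp_mem : ∀ a g, comp a g ∈ deg g
  comp_add : ∀ a b g, comp (a + b) g = comp a g + comp b g
  comp_of_mem : ∀ {a : A} {g : G}, a ∈ deg g → comp a g = a
  comp_of_mem_ne : ∀ {a : A} {g g' : G}, a ∈ deg g → g' ≠ g → comp a g' = 0
  finite_support : ∀ a : A, (Function.support (comp a)).Finite
  sum_comp : ∀ a : A, ∑ᶠ g, comp a g = a

namespace GradedStr

variable {G : Type u} [CommGroup G] {A : Type v} [CommRing A]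

/-- `a` is homogeneous: it lies in some graded piece. -/
def IsHomog (𝒜 : GradedStr G A) (a : A) : Prop := ∃ g, a ∈ 𝒜.deg g

/-- A `G`-graded field: a nonzero graded ring in which every nonzero homogeneous
element is invertible. -/
def IsGradedField (𝒜 : GradedStr G A) : Prop :=
  Nontrivial A ∧ ∀ a : A, 𝒜.IsHomog a → a ≠ 0 → IsUnit a

/-- A graded subring: a subring stable under taking homogeneous components. -/
def IsGradedSubring (𝒜 : GradedStr G A) (S : Subring A) : Prop :=
  ∀ x ∈ S, ∀ g, 𝒜.comp x g ∈ S

/-- A graded subfield of a graded field: a graded subring containing the inverses of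
its nonzero homogeneous elements. -/
def IsGradedSubfield (𝒜 : GradedStr G A) (S : Subring A) : Prop :=
  𝒜.IsGradedSubring S ∧ ∀ x ∈ S, 𝒜.IsHomog x → x ≠ 0 → Ring.inverse x ∈ S

/-- The additive subgroup of homogeneous polynomials of grading `h` in `K[g₀⁻¹ T]`,
the polynomial ring in which `T` is declared homogeneous of grading `g₀`: the
coefficient of `T^n` must be homogeneous of grading `h * g₀⁻ⁿ`. -/
def polyDeg (𝒜 : GradedStr G A) (g₀ h : G) : AddSubgroup (Polynomial A) where
  carrier := {p | ∀ n : ℕ, p.coeff n ∈ 𝒜.deg (h * (g₀ ^ n)⁻¹)}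
  zero_mem' := by intro n; simpa using (𝒜.deg (h * (g₀ ^ n)⁻¹)).zero_mem
  add_mem' := by
    intro p q hp hq n
    rw [Polynomial.coeff_add]
    exact (𝒜.deg _).add_mem (hp n) (hq n)
  neg_mem' := by
    intro p hp n
    rw [Polynomial.coeff_neg]
    exact (𝒜.deg _).neg_mem (hp n)

/-- A homogeneous polynomial in `K[g₀⁻¹T]`. -/
def IsHomogPoly (𝒜 : GradedStr G A) (g₀ : G) (p : Polynomial A) : Prop :=
  ∃ h, p ∈ 𝒜.polyDeg g₀ h

/-- The graded fraction field of a graded subring of a graded field, computed inside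
the ambient graded field: the subring generated by `S` together with the inverses of
the nonzero homogeneous elements of `S`. -/
def fracIn (𝒜 : GradedStr G A) (S : Subring A) : Subring A :=
  Subring.closure (↑S ∪ {y : A | ∃ x ∈ S, x ≠ 0 ∧ 𝒜.IsHomog x ∧ y = Ring.inverse x})

end GradedStr

/-- `x` is integral over the subring `S` (satisfies a monic polynomial equation with
coefficients in `S`). -/
def IntegralOver {A : Type v} [CommRing A] (S : Subring A) (x : A) : Prop :=
  ∃ p : Polynomial A, p.Monic ∧ (∀ n, p.coeff n ∈ S) ∧ Polynomial.eval x p = 0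

/-- Algebraic independence of a family of elements over a subring: the evaluation map
from the (multivariate) polynomial ring is injective.  (For homogeneous elements this
is graded algebraic independence, the grading playing no role in injectivity.) -/
def AlgIndepOver {A : Type v} [CommRing A] {ι : Type*} (S : Subring A) (T : ι → A) : Prop :=
  Function.Injective (MvPolynomial.eval₂Hom S.subtype T)

/-- A graded valuation ring of the graded subfield `F` of the ambient graded field:
a graded subring `O ⊆ F` such that every nonzero homogeneous element `f` of `F`
satisfies `f ∈ O` or `f⁻¹ ∈ O`. -/
def IsGVRofSubfield {G : Type u} [CommGroup G] {A : Type v} [CommRing A]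
    (𝒜 : GradedStr G A) (F : Subring A) (O : Subring A) : Prop :=
  O ≤ F ∧ 𝒜.IsGradedSubring O ∧
    ∀ f ∈ F, f ≠ 0 → 𝒜.IsHomog f → f ∈ O ∨ Ring.inverse f ∈ O

namespace GradedStr

variable {G : Type u} [CommGroup G] {A : Type v} [CommRing A] (𝒜 : GradedStr G A)

lemma comp_zero' (g : G) : 𝒜.comp 0 g = 0 := 𝒜.comp_of_mem (𝒜.deg g).zero_mem

/-- `comp` as an additive hom. -/
def compHom (g : G) : A →+ A where
  toFun a := 𝒜.comp a g
  map_zero' := 𝒜.comp_zero' g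
  map_add' a b := 𝒜.comp_add a b g

lemma compHom_apply (g : G) (a : A) : 𝒜.compHom g a = 𝒜.comp a g := rfl

lemma comp_neg' (a : A) (g : G) : 𝒜.comp (-a) g = - 𝒜.comp a g := map_neg (𝒜.compHom g) a

lemma comp_sum' {ι : Type*} (s : Finset ι) (f : ι → A) (g : G) :
    𝒜.comp (∑ i ∈ s, f i) g = ∑ i ∈ s, 𝒜.comp (f i) g := map_sum (𝒜.compHom g) f s

lemma mem_of_comp_mem {S : Type*} [SetLike S A] [AddSubmonoidClass S A] (N : S) {a : A}
    (h : ∀ g, 𝒜.comp a g ∈ N) : a ∈ N := by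
  rw [← 𝒜.sum_comp a, finsum_eq_sum _ (𝒜.finite_support a)]
  exact sum_mem fun g _ => h g

lemma homog_induction {P : A → Prop} (zero : P 0) (hadd : ∀ a b, P a → P b → P (a + b))
    (homog : ∀ g, ∀ a ∈ 𝒜.deg g, P a) (a : A) : P a := by
  rw [← 𝒜.sum_comp a, finsum_eq_sum _ (𝒜.finite_support a)]
  exact Finset.sum_induction _ P hadd zero fun g _ => homog g _ (𝒜.comp_mem a g)

lemma eq_zero_of_comp {a : A} (h : ∀ g, 𝒜.comp a g = 0) : a = 0 := by
  rw [← 𝒜.sum_comp a]; simp [h]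

lemma comp_mul_left {a : A} {g : G} (ha : a ∈ 𝒜.deg g) (x : A) (h : G) :
    𝒜.comp (a * x) h = a * 𝒜.comp x (g⁻¹ * h) := by
  refine 𝒜.homog_induction (P := fun x => 𝒜.comp (a * x) h = a * 𝒜.comp x (g⁻¹ * h))
    (by simp [comp_zero']) (fun x y hx hy => by rw [mul_add, comp_add, hx, hy, comp_add, mul_add])
    ?_ x
  intro g' x hx
  by_cases e : h = g * g'
  · subst e
    rw [inv_mul_cancel_left, 𝒜.comp_of_mem hx, 𝒜.comp_of_mem (𝒜.mul_mem ha hx)]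
  · rw [𝒜.comp_of_mem_ne (𝒜.mul_mem ha hx) e, 𝒜.comp_of_mem_ne hx, mul_zero]
    rintro rfl; simp at e

lemma comp_mul_right {a : A} {g : G} (ha : a ∈ 𝒜.deg g) (x : A) (h : G) :
    𝒜.comp (x * a) h = 𝒜.comp x (g⁻¹ * h) * a := by
  rw [mul_comm, 𝒜.comp_mul_left ha, mul_comm]

lemma IsHomog.mul {a b : A} (ha : 𝒜.IsHomog a) (hb : 𝒜.IsHomog b) : 𝒜.IsHomog (a * b) := by
  obtain ⟨g, hg⟩ := ha; obtain ⟨h, hh⟩ := hb; exact ⟨_, 𝒜.mul_mem hg hh⟩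

lemma pow_mem_deg {a : A} {g : G} (ha : a ∈ 𝒜.deg g) (n : ℕ) : a ^ n ∈ 𝒜.deg (g ^ n) := by
  induction n with
  | zero => rw [pow_zero, pow_zero]; exact 𝒜.one_mem
  | succ n ih => rw [pow_succ, pow_succ]; exact 𝒜.mul_mem ih ha

lemma comp_homog (a : A) (g : G) : 𝒜.IsHomog (𝒜.comp a g) := ⟨g, 𝒜.comp_mem a g⟩

/-- if `x` is in a graded piece and `x y = 1` then `y` is homogeneous -/
lemma homog_of_mul_eq_one {x y : A} (hx : 𝒜.IsHomog x) (h : x * y = 1) : 𝒜.IsHomog y := by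
  obtain ⟨g, hg⟩ := hx
  have h1 : x * 𝒜.comp y (g⁻¹ * 1) = 1 := by
    rw [← 𝒜.comp_mul_left hg, h, 𝒜.comp_of_mem 𝒜.one_mem]
  have : y = 𝒜.comp y (g⁻¹ * 1) := by
    calc y = (x * 𝒜.comp y (g⁻¹ * 1)) * y := by rw [h1, one_mul]
      _ = (x * y) * 𝒜.comp y (g⁻¹ * 1) := by ring
      _ = _ := by rw [h, one_mul]
  rw [this]; exact 𝒜.comp_homog _ _

variable {𝒜}

lemma IsGradedField.mul_inv (hL : 𝒜.IsGradedField) {x : A} (hx : 𝒜.IsHomog x) (h0 : x ≠ 0) :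
    x * Ring.inverse x = 1 := Ring.mul_inverse_cancel x (hL.2 x hx h0)

lemma inverse_eq {x y : A} (h : x * y = 1) : Ring.inverse x = y :=
  by
  calc Ring.inverse x = Ring.inverse x * (x * y) := by rw [h, mul_one]
    _ = (Ring.inverse x * x) * y := by ring
    _ = y := by rw [Ring.inverse_mul_cancel x (IsUnit.of_mul_eq_one y h), one_mul]

lemma IsGradedField.inv_homog (hL : 𝒜.IsGradedField) {x : A} (hx : 𝒜.IsHomog x) (h0 : x ≠ 0) :
    𝒜.IsHomog (Ring.inverse x) := 𝒜.homog_of_mul_eq_one hx (hL.mul_inv hx h0)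

lemma IsGradedField.inv_ne (hL : 𝒜.IsGradedField) {x : A} (hx : 𝒜.IsHomog x) (h0 : x ≠ 0) :
    Ring.inverse x ≠ 0 := by
  have := hL.1
  intro h
  have := hL.mul_inv hx h0
  rw [h, mul_zero] at this
  exact zero_ne_one this

lemma IsGradedField.mul_ne (hL : 𝒜.IsGradedField) {x y : A} (hx : 𝒜.IsHomog x) (h0 : x ≠ 0)
    (hy : y ≠ 0) : x * y ≠ 0 := fun h => hy <| by
  calc y = (x * Ring.inverse x) * y := by rw [hL.mul_inv hx h0, one_mul]
    _ = (x * y) * Ring.inverse x := by ring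
    _ = 0 := by rw [h, zero_mul]

lemma IsGradedField.inv_inv (hL : 𝒜.IsGradedField) {x : A} (hx : 𝒜.IsHomog x) (h0 : x ≠ 0) :
    Ring.inverse (Ring.inverse x) = x :=
  inverse_eq (by rw [mul_comm]; exact hL.mul_inv hx h0)

/-- Closure of a set whose components lie in the closure is graded. -/
lemma isGradedSubring_closure {X : Set A}
    (hX : ∀ x ∈ X, ∀ g, 𝒜.comp x g ∈ Subring.closure X) :
    𝒜.IsGradedSubring (Subring.closure X) := by
  intro x hx
  induction hx using Subring.closure_induction with
  | mem x hx => exact hX x hx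
  | zero => intro g; rw [comp_zero']; exact zero_mem _
  | one =>
    intro g
    by_cases h : g = 1
    · subst h; rw [𝒜.comp_of_mem 𝒜.one_mem]; exact OneMemClass.one_mem _
    · rw [𝒜.comp_of_mem_ne 𝒜.one_mem h]; exact zero_mem _
  | add x y _ _ hx hy => intro g; rw [comp_add]; exact add_mem (hx g) (hy g)
  | neg x _ hx => intro g; rw [comp_neg']; exact neg_mem (hx g)
  | mul x y _ _ hx hy =>
    intro h
    rw [← 𝒜.sum_comp x, finsum_eq_sum _ (𝒜.finite_support x), Finset.sum_mul, comp_sum']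
    refine sum_mem fun g _ => ?_
    rw [𝒜.comp_mul_left (𝒜.comp_mem x g)]
    exact MulMemClass.mul_mem (hx _) (hy _)

lemma comp_mem_of_homog {S : Subring A} {x : A} (hx : 𝒜.IsHomog x) (h : x ∈ S) (g : G) :
    𝒜.comp x g ∈ S := by
  obtain ⟨g', hg⟩ := hx
  by_cases e : g = g'
  · subst e; rwa [𝒜.comp_of_mem hg]
  · rw [𝒜.comp_of_mem_ne hg e]; exact zero_mem _

end GradedStr

open GradedStr

section Chevalley

variable {G : Type u} [CommGroup G] {L : Type v} [CommRing L]

/-- `V`-span of `x f^i`, `x ∈ I`, `i ≤ n`. -/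
def EE (V : Subring L) (I : Set L) (f : L) (n : ℕ) : Submodule V L :=
  Submodule.span V {y | ∃ x ∈ I, ∃ i ≤ n, y = x * f ^ i}

lemma EE_zero (V : Subring L) (I : Set L) (f : L) : EE V I f 0 = Submodule.span V I := by
  unfold EE; congr 1; ext y; simp

lemma EE_mono (V : Subring L) (I : Set L) (f : L) {m n : ℕ} (h : m ≤ n) :
    EE V I f m ≤ EE V I f n :=
  Submodule.span_mono fun _ ⟨x, hx, i, hi, e⟩ => ⟨x, hx, i, hi.trans h, e⟩

lemma EE_smul {V : Subring L} {I : Set L} {f : L} {n : ℕ} {v y : L} (hv : v ∈ V)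
    (hy : y ∈ EE V I f n) : v * y ∈ EE V I f n := (EE V I f n).smul_mem ⟨v, hv⟩ hy

lemma EE_mul {V : Subring L} {I : Set L} {f : L} {n : ℕ} {y : L}
    (hy : y ∈ EE V I f n) (d : ℕ) : f ^ d * y ∈ EE V I f (n + d) := by
  unfold EE at hy
  induction hy using Submodule.span_induction with
  | mem y hy =>
    obtain ⟨x, hx, i, hi, rfl⟩ := hy
    exact Submodule.subset_span ⟨x, hx, i + d, by omega, by ring⟩
  | zero => simp
  | add x y _ _ hx hy => rw [mul_add]; exact add_mem hx hy
  | smul a x _ hx =>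
    rw [mul_smul_comm]; exact Submodule.smul_mem _ _ hx

/-- multiply out the denominators -/
lemma EE_clear {V : Subring L} {I : Set L} {f u : L} (hfu : f * u = 1) {n : ℕ} {y : L}
    (hy : y ∈ EE V I u n) {s : ℕ} (hs : n ≤ s) : f ^ s * y ∈ EE V I f s := by
  unfold EE at hy
  induction hy using Submodule.span_induction with
  | mem y hy =>
    obtain ⟨x, hx, i, hi, rfl⟩ := hy
    refine Submodule.subset_span ⟨x, hx, s - i, by omega, ?_⟩
    have : f ^ s = f ^ (s - i) * f ^ i := by rw [← pow_add]; congr 1; omega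
    rw [this]
    calc _ = x * f ^ (s - i) * (f * u) ^ i := by ring
      _ = _ := by rw [hfu]; simp
  | zero => simp
  | add x y _ _ hx hy => rw [mul_add]; exact add_mem hx hy
  | smul a x _ hx =>
    rw [mul_smul_comm]; exact Submodule.smul_mem _ _ hx

lemma EE_top {V : Subring L} {I : Set L} {f : L} {n : ℕ} {y : L}
    (hy : y ∈ EE V I f (n + 1)) :
    ∃ a ∈ Submodule.span V I, y - a * f ^ (n + 1) ∈ EE V I f n := by
  unfold EE at hy
  induction hy using Submodule.span_induction with
  | mem y hy =>
    obtain ⟨x, hx, i, hi, rfl⟩ := hy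
    rcases Nat.lt_or_ge n i with h | h
    · obtain rfl : i = n + 1 := by omega
      exact ⟨x, Submodule.subset_span hx, by simp⟩
    · exact ⟨0, zero_mem _, by
        rw [zero_mul, sub_zero]; exact Submodule.subset_span ⟨x, hx, i, h, rfl⟩⟩
  | zero => exact ⟨0, zero_mem _, by simp⟩
  | add x y _ _ hx hy =>
    obtain ⟨a, ha, h⟩ := hx
    obtain ⟨b, hb, h'⟩ := hy
    refine ⟨a + b, add_mem ha hb, ?_⟩
    convert add_mem h h' using 1; ring
  | smul v x _ hx =>
    obtain ⟨a, ha, h⟩ := hx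
    refine ⟨v • a, Submodule.smul_mem _ _ ha, ?_⟩
    convert Submodule.smul_mem _ v h using 1
    rw [smul_sub, smul_mul_assoc]

lemma EE_bot {V : Subring L} {I : Set L} {f u : L} (hfu : f * u = 1) {m n : ℕ} {y : L}
    (hmn : m ≤ n + 1) (hy : y ∈ EE V I u m) :
    ∃ b ∈ Submodule.span V I, (y - b) * f ^ (n + 1) ∈ EE V I f n := by
  unfold EE at hy
  induction hy using Submodule.span_induction with
  | mem y hy =>
    obtain ⟨x, hx, i, hi, rfl⟩ := hy
    rcases Nat.eq_zero_or_pos i with h | h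
    · subst h
      exact ⟨x, Submodule.subset_span hx, by simp⟩
    · refine ⟨0, zero_mem _, Submodule.subset_span ⟨x, hx, n + 1 - i, by omega, ?_⟩⟩
      have : f ^ (n + 1) = f ^ (n + 1 - i) * f ^ i := by rw [← pow_add]; congr 1; omega
      rw [this]
      calc _ = x * f ^ (n + 1 - i) * (f * u) ^ i := by ring
        _ = _ := by rw [hfu]; simp
  | zero => exact ⟨0, zero_mem _, by simp⟩
  | add x y _ _ hx hy =>
    obtain ⟨a, ha, h⟩ := hx
    obtain ⟨b, hb, h'⟩ := hy
    refine ⟨a + b, add_mem ha hb, ?_⟩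
    convert add_mem h h' using 1; ring
  | smul v x _ hx =>
    obtain ⟨a, ha, h⟩ := hx
    refine ⟨v • a, Submodule.smul_mem _ _ ha, ?_⟩
    convert Submodule.smul_mem _ v h using 1
    rw [← smul_sub, smul_mul_assoc]

lemma span_le_V {V : Subring L} {I : Set L} (hI : I ⊆ V) {y : L}
    (hy : y ∈ Submodule.span V I) : y ∈ V := by
  induction hy using Submodule.span_induction with
  | mem y hy => exact hI hy
  | zero => exact zero_mem _
  | add x y _ _ hx hy => exact add_mem hx hy
  | smul v x _ hx => exact mul_mem v.2 hx

/-- The classical degree reduction. -/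
lemma chev_reduce {V : Subring L} {I : Set L} (hI : I ⊆ V) {M : Submonoid L}
    (hMV : ∀ s ∈ M, s ∈ V) (hd : ∀ s ∈ M, s ∉ Submodule.span V I) :
    ∀ (N : ℕ) {f u : L}, f * u = 1 → ∀ {n m : ℕ}, n + m ≤ N → ∀ {s s' : L}, s ∈ M → s' ∈ M →
      s ∈ EE V I f n → s' ∈ EE V I u m → False := by
  intro N
  induction N with
  | zero =>
    intro f u hfu n m hnm s s' hs hs' h h'
    obtain rfl : n = 0 := by omega
    exact hd s hs (by rwa [EE_zero] at h)
  | succ N ih =>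
    -- the case m ≤ n
    have key : ∀ {f u : L}, f * u = 1 → ∀ {n m : ℕ}, m ≤ n → n + m ≤ N + 1 → ∀ {s s' : L},
        s ∈ M → s' ∈ M → s ∈ EE V I f n → s' ∈ EE V I u m → False := by
      intro f u hfu n m hmn hnm s s' hs hs' h h'
      rcases n with _ | n
      · exact hd s hs (by rwa [EE_zero] at h)
      obtain ⟨a, ha, h1⟩ := EE_top h
      obtain ⟨b, hb, h2⟩ := EE_bot hfu hmn h'
      refine ih hfu (n := n) (m := m) (by omega) (mul_mem hs hs') hs' ?_ h'
      have hbV := span_le_V hI hb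
      have haV := span_le_V hI ha
      have e : s * s' = s * b + (s' - b) * (s - a * f ^ (n + 1))
          + a * ((s' - b) * f ^ (n + 1)) := by ring
      rw [e]
      refine add_mem (add_mem ?_ (EE_smul (sub_mem (hMV _ hs') hbV) h1)) (EE_smul haV h2)
      refine EE_smul (hMV _ hs) (EE_mono V I f (Nat.zero_le n) ?_)
      rwa [EE_zero]
    intro f u hfu n m hnm s s' hs hs' h h'
    rcases le_total m n with hmn | hmn
    · exact key hfu hmn hnm hs hs' h h'
    · exact key (by rwa [mul_comm]) hmn (by omega) hs' hs h' h

/-- `V[f]` -/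
def adj (V : Subring L) (f : L) : Subring L := Subring.closure (↑V ∪ {f})

lemma le_adj (V : Subring L) (f : L) : V ≤ adj V f :=
  fun _ h => Subring.subset_closure (Or.inl h)

lemma mem_adj (V : Subring L) (f : L) : f ∈ adj V f := Subring.subset_closure (Or.inr rfl)

lemma adj_graded {𝒜 : GradedStr G L} {V : Subring L} (hV : 𝒜.IsGradedSubring V) {f : L}
    (hf : 𝒜.IsHomog f) : 𝒜.IsGradedSubring (adj V f) := by
  refine isGradedSubring_closure ?_
  rintro x (hx | rfl) g
  · exact le_adj V f (hV x hx g)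
  · exact comp_mem_of_homog hf (mem_adj V x) g

lemma adj_mul_EE {V : Subring L} {I : Set L} {f : L} {w : L} (hw : w ∈ adj V f) :
    ∀ n y, y ∈ EE V I f n → ∃ d, w * y ∈ EE V I f d := by
  unfold adj at hw
  induction hw using Subring.closure_induction with
  | mem w hw =>
    intro n y hy
    rcases hw with hw | rfl
    · exact ⟨n, EE_smul hw hy⟩
    · exact ⟨n + 1, by simpa using EE_mul hy 1⟩
  | zero => exact fun n y hy => ⟨0, by simp⟩
  | one => exact fun n y hy => ⟨n, by simpa⟩
  | add x z _ _ hx hz =>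
    intro n y hy
    obtain ⟨d, hd⟩ := hx n y hy
    obtain ⟨e, he⟩ := hz n y hy
    refine ⟨max d e, ?_⟩
    rw [add_mul]
    exact add_mem (EE_mono _ _ _ (le_max_left _ _) hd) (EE_mono _ _ _ (le_max_right _ _) he)
  | neg x _ hx =>
    intro n y hy
    obtain ⟨d, hd⟩ := hx n y hy
    exact ⟨d, by rw [neg_mul]; exact neg_mem hd⟩
  | mul x z _ _ hx hz =>
    intro n y hy
    obtain ⟨d, hd⟩ := hz n y hy
    rw [mul_assoc]
    exact hx _ _ hd

lemma adj_span {V : Subring L} {I : Set L} {f : L} {y : L}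
    (hy : y ∈ Submodule.span (adj V f) I) : ∃ n, y ∈ EE V I f n := by
  induction hy using Submodule.span_induction with
  | mem y hy => exact ⟨0, by rw [EE_zero]; exact Submodule.subset_span hy⟩
  | zero => exact ⟨0, zero_mem _⟩
  | add x y _ _ hx hy =>
    obtain ⟨d, hd⟩ := hx
    obtain ⟨e, he⟩ := hy
    exact ⟨max d e, add_mem (EE_mono _ _ _ (le_max_left _ _) hd)
      (EE_mono _ _ _ (le_max_right _ _) he)⟩
  | smul v x _ hx =>
    obtain ⟨d, hd⟩ := hx
    exact adj_mul_EE v.2 _ _ hd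

lemma span_mono_ring {V W : Subring L} (h : V ≤ W) {I : Set L} {y : L}
    (hy : y ∈ Submodule.span V I) : y ∈ Submodule.span W I := by
  induction hy using Submodule.span_induction with
  | mem y hy => exact Submodule.subset_span hy
  | zero => exact zero_mem _
  | add x y _ _ hx hy => exact add_mem hx hy
  | smul v x _ hx => exact Submodule.smul_mem _ (⟨v, h v.2⟩ : W) hx

lemma span_sSup {c : Set (Subring L)} (hne : c.Nonempty) (hc : IsChain (· ≤ ·) c) {I : Set L}
    {y : L} (hy : y ∈ Submodule.span (sSup c : Subring L) I) :
    ∃ V ∈ c, y ∈ Submodule.span V I := by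
  induction hy using Submodule.span_induction with
  | mem y hy => obtain ⟨V, hV⟩ := hne; exact ⟨V, hV, Submodule.subset_span hy⟩
  | zero => obtain ⟨V, hV⟩ := hne; exact ⟨V, hV, zero_mem _⟩
  | add x y _ _ hx hy =>
    obtain ⟨V, hV, h⟩ := hx
    obtain ⟨W, hW, h'⟩ := hy
    rcases hc.total hV hW with hl | hl
    · exact ⟨W, hW, add_mem (span_mono_ring hl h) h'⟩
    · exact ⟨V, hV, add_mem h (span_mono_ring hl h')⟩
  | smul v x _ hx =>
    obtain ⟨V, hV, h⟩ := hx
    obtain ⟨W, hW, h'⟩ := (Subring.mem_sSup_of_directedOn hne hc.directedOn).1 v.2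
    rcases hc.total hV hW with hl | hl
    · exact ⟨W, hW, Submodule.smul_mem _ (⟨v, h'⟩ : W) (span_mono_ring hl h)⟩
    · exact ⟨V, hV, Submodule.smul_mem _ (⟨v, hl h'⟩ : V) h⟩

/-- Graded Chevalley extension theorem. -/
theorem chevalley {𝒜 : GradedStr G L} (hL : 𝒜.IsGradedField) {F R : Subring L}
    (hF : 𝒜.IsGradedSubfield F) (hR : 𝒜.IsGradedSubring R) (hRF : R ≤ F)
    {I : Set L} (hI : I ⊆ R) {M : Submonoid L} (hM : ∀ s ∈ M, s ∈ R)
    (hd : ∀ s ∈ M, s ∉ Submodule.span R I) :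
    ∃ V : Subring L, IsGVRofSubfield 𝒜 F V ∧ R ≤ V ∧ (∀ s ∈ M, s ∉ Submodule.span V I) ∧
      ∀ s ∈ M, 𝒜.IsHomog s → s ≠ 0 → Ring.inverse s ∈ V := by
  obtain ⟨V, hRV, hV⟩ := zorn_le_nonempty₀
    {V : Subring L | (R ≤ V ∧ V ≤ F) ∧ 𝒜.IsGradedSubring V ∧ ∀ s ∈ M, s ∉ Submodule.span V I}
    (by
      intro c hcs hc W hW
      have hne : c.Nonempty := ⟨W, hW⟩
      refine ⟨sSup c, ⟨⟨(hcs hW).1.1.trans (le_sSup hW), sSup_le fun V hV => (hcs hV).1.2⟩, ?_, ?_⟩,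
        fun z hz => le_sSup hz⟩
      · intro x hx g
        obtain ⟨V, hV, h⟩ := (Subring.mem_sSup_of_directedOn hne hc.directedOn).1 hx
        exact le_sSup hV ((hcs hV).2.1 x h g)
      · intro s hs h
        obtain ⟨V, hV, h⟩ := span_sSup hne hc h
        exact (hcs hV).2.2 s hs h)
    R ⟨⟨le_rfl, hRF⟩, hR, hd⟩
  obtain ⟨⟨-, hVF⟩, hVg, hVd⟩ := hV.1
  have hIV : I ⊆ V := fun x hx => hRV (hI hx)
  have hMV : ∀ s ∈ M, s ∈ V := fun s hs => hRV (hM s hs)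
  -- enlarging V meets M
  have step : ∀ f ∈ F, 𝒜.IsHomog f → f ∉ V → ∃ s ∈ M, ∃ n, s ∈ EE V I f n := by
    intro f hfF hf hfV
    by_contra hcon
    push Not at hcon
    refine hfV (hV.2 (y := adj V f) ⟨⟨hRV.trans (le_adj V f), ?_⟩, adj_graded hVg hf, ?_⟩
      (le_adj V f) (mem_adj V f))
    · refine Subring.closure_le.2 ?_
      rintro x (hx | rfl)
      exacts [hVF hx, hfF]
    · intro s hs h
      obtain ⟨n, hn⟩ := adj_span h
      exact hcon s hs n hn
  refine ⟨V, ⟨hVF, hVg, ?_⟩, hRV, hVd, ?_⟩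
  · intro f hf h0 hh
    by_contra hcon
    push Not at hcon
    obtain ⟨s, hs, n, hn⟩ := step f hf hh hcon.1
    obtain ⟨s', hs', m, hm⟩ := step _ (hF.2 f hf hh h0) (hL.inv_homog hh h0) hcon.2
    exact chev_reduce hIV hMV hVd (n + m) (hL.mul_inv hh h0) le_rfl hs hs' hn hm
  · intro s hs hh h0
    by_contra hcon
    obtain ⟨s', hs', m, hm⟩ := step _ (hF.2 s (hRF (hM s hs)) hh h0) (hL.inv_homog hh h0) hcon
    refine hVd (s ^ m * s') (mul_mem (pow_mem hs m) hs') ?_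
    have h1 := EE_clear (hL.mul_inv hh h0) hm le_rfl
    -- powers of s are in V
    have h2 : ∀ y, y ∈ EE V I s m → y ∈ Submodule.span V I := by
      intro y hy
      refine (Submodule.span_le.2 ?_ : EE V I s m ≤ Submodule.span V I) hy
      rintro _ ⟨x, hx, i, -, rfl⟩
      rw [mul_comm]
      exact Submodule.smul_mem _ (⟨s ^ i, pow_mem (hMV s hs) i⟩ : V) (Submodule.subset_span hx)
    exact h2 _ h1

end Chevalley

section MaxIdeal

variable {G : Type u} [CommGroup G] {L : Type v} [CommRing L] {𝒜 : GradedStr G L}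

/-- Homogeneous nonunits of `O`. -/
def nonU (𝒜 : GradedStr G L) (O : Subring L) : Set L :=
  {x | x ∈ O ∧ 𝒜.IsHomog x ∧ (x = 0 ∨ Ring.inverse x ∉ O)}

lemma nonU_zero (O : Subring L) : (0 : L) ∈ nonU 𝒜 O :=
  ⟨zero_mem _, ⟨1, zero_mem _⟩, Or.inl rfl⟩

lemma nonU_smul (hL : 𝒜.IsGradedField) {O : Subring L} {a x : L} (ha : a ∈ O)
    (hah : 𝒜.IsHomog a) (hx : x ∈ nonU 𝒜 O) : a * x ∈ nonU 𝒜 O := by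
  obtain ⟨hxO, hxh, hx⟩ := hx
  have hh := IsHomog.mul 𝒜 hah hxh
  refine ⟨MulMemClass.mul_mem ha hxO, hh, ?_⟩
  by_cases h0 : a * x = 0
  · exact Or.inl h0
  refine Or.inr fun hinv => ?_
  rcases hx with rfl | hx
  · simp at h0
  · apply hx
    have : x * (a * Ring.inverse (a * x)) = 1 := by
      rw [← mul_assoc, mul_comm x a]; exact hL.mul_inv hh h0
    rw [inverse_eq this]
    exact MulMemClass.mul_mem ha hinv

lemma nonU_add (hL : 𝒜.IsGradedField) {F O : Subring L} (hF : 𝒜.IsGradedSubfield F)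
    (hO : IsGVRofSubfield 𝒜 F O) {x y : L} {g : G}
    (hx : x ∈ nonU 𝒜 O) (hy : y ∈ nonU 𝒜 O) (hxg : x ∈ 𝒜.deg g) (hyg : y ∈ 𝒜.deg g) :
    x + y ∈ nonU 𝒜 O := by
  -- symmetric core
  have core : ∀ {x y : L}, x ∈ nonU 𝒜 O → y ∈ nonU 𝒜 O → y ≠ 0 → x * Ring.inverse y ∈ O →
      x + y ≠ 0 → 𝒜.IsHomog (x + y) → Ring.inverse (x + y) ∉ O := by
    intro x y hx hy hy0 hxy hne hh hinv
    rcases hy.2.2 with h | h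
    · exact hy0 h
    · apply h
      have e : y * ((1 + x * Ring.inverse y) * Ring.inverse (x + y)) = 1 := by
        have : y * (1 + x * Ring.inverse y) = x + y := by
          calc _ = y + x * (y * Ring.inverse y) := by ring
            _ = _ := by rw [hL.mul_inv hy.2.1 hy0]; ring
        rw [← mul_assoc, this, hL.mul_inv hh hne]
      rw [inverse_eq e]
      exact MulMemClass.mul_mem (add_mem (OneMemClass.one_mem _) hxy) hinv
  have hh : 𝒜.IsHomog (x + y) := ⟨g, add_mem hxg hyg⟩
  refine ⟨add_mem hx.1 hy.1, hh, ?_⟩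
  by_cases hne : x + y = 0
  · exact Or.inl hne
  right
  by_cases hx0 : x = 0
  · subst hx0
    rw [zero_add] at hne ⊢
    exact hy.2.2.resolve_left hne
  by_cases hy0 : y = 0
  · subst hy0
    rw [add_zero] at hne ⊢
    exact hx.2.2.resolve_left hne
  have hiy := hL.inv_homog hy.2.1 hy0
  have hz : x * Ring.inverse y ∈ F :=
    MulMemClass.mul_mem (hO.1 hx.1) (hF.2 y (hO.1 hy.1) hy.2.1 hy0)
  rcases hO.2.2 _ hz (hL.mul_ne hx.2.1 hx0 (hL.inv_ne hy.2.1 hy0))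
    (IsHomog.mul 𝒜 hx.2.1 hiy) with h | h
  · exact core hx hy hy0 h hne hh
  · have e : (x * Ring.inverse y) * (y * Ring.inverse x) = 1 := by
      calc _ = (x * Ring.inverse x) * (y * Ring.inverse y) := by ring
        _ = 1 := by rw [hL.mul_inv hx.2.1 hx0, hL.mul_inv hy.2.1 hy0, one_mul]
    rw [inverse_eq e] at h
    rw [add_comm] at hne hh ⊢
    exact core hy hx hx0 h hne hh

/-- The graded maximal ideal. -/
def mI (hL : 𝒜.IsGradedField) {F O : Subring L} (hF : 𝒜.IsGradedSubfield F)
    (hO : IsGVRofSubfield 𝒜 F O) : Ideal O where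
  carrier := {x | ∀ g, 𝒜.comp x g ∈ nonU 𝒜 O}
  zero_mem' := by
    intro g
    rw [ZeroMemClass.coe_zero, comp_zero']
    exact nonU_zero O
  add_mem' := by
    intro x y hx hy g
    rw [Subring.coe_add, comp_add]
    exact nonU_add hL hF hO (hx g) (hy g) (𝒜.comp_mem _ _) (𝒜.comp_mem _ _)
  smul_mem' := by
    intro a x hx h
    rw [smul_eq_mul, Subring.coe_mul, ← 𝒜.sum_comp a, finsum_eq_sum _ (𝒜.finite_support _),
      Finset.sum_mul, comp_sum']
    refine (Finset.sum_induction _ (fun z => z ∈ nonU 𝒜 O ∧ z ∈ 𝒜.deg h) ?_ ?_ ?_).1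
    · exact fun x y hx hy => ⟨nonU_add hL hF hO hx.1 hy.1 hx.2 hy.2, add_mem hx.2 hy.2⟩
    · exact ⟨nonU_zero O, zero_mem _⟩
    · intro g _
      refine ⟨?_, 𝒜.comp_mem _ _⟩
      rw [𝒜.comp_mul_left (𝒜.comp_mem _ _)]
      exact nonU_smul hL (hO.2.1 _ a.2 g) (𝒜.comp_homog _ _) (hx _)

lemma mem_mI_of_nonU (hL : 𝒜.IsGradedField) {F O : Subring L} (hF : 𝒜.IsGradedSubfield F)
    (hO : IsGVRofSubfield 𝒜 F O) {x : O} (hx : (x : L) ∈ nonU 𝒜 O) : x ∈ mI hL hF hO := by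
  intro g
  obtain ⟨g', hg⟩ := hx.2.1
  by_cases e : g = g'
  · subst e; rwa [𝒜.comp_of_mem hg]
  · rw [𝒜.comp_of_mem_ne hg e]; exact nonU_zero O

/-- A graded subfield inside `O` meets the maximal ideal trivially. -/
lemma subfield_mI (hL : 𝒜.IsGradedField) {F O E : Subring L} (hF : 𝒜.IsGradedSubfield F)
    (hO : IsGVRofSubfield 𝒜 F O) (hE : 𝒜.IsGradedSubfield E) (hEO : E ≤ O) {x : O}
    (hx : x ∈ mI hL hF hO) (hxE : (x : L) ∈ E) : (x : L) = 0 := by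
  refine 𝒜.eq_zero_of_comp fun g => ?_
  obtain ⟨-, h2, h3⟩ := hx g
  by_contra h0
  exact (h3.resolve_left h0) (hEO (hE.2 _ (hE.1 _ hxE g) h2 h0))

lemma one_notMem_mI (hL : 𝒜.IsGradedField) {F O : Subring L} (hF : 𝒜.IsGradedSubfield F)
    (hO : IsGVRofSubfield 𝒜 F O) : (1 : O) ∉ mI hL hF hO := by
  have := hL.1
  intro h
  have := h 1
  rw [Subring.coe_one, 𝒜.comp_of_mem 𝒜.one_mem] at this
  rcases this.2.2 with h | h
  · exact one_ne_zero h
  · rw [Ring.inverse_one] at h; exact h (OneMemClass.one_mem _)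

lemma top_subfield : 𝒜.IsGradedSubfield (⊤ : Subring L) :=
  ⟨fun _ _ _ => trivial, fun _ _ _ _ => trivial⟩

end MaxIdeal

section Comm

attribute [local instance] MvPolynomial.algebraMvPolynomial

variable {k κ σ : Type*} [CommRing k] [CommRing κ]

lemma regular_of_units {Q : MvPolynomial σ κ} (hQ : Q ≠ 0)
    (hu : ∀ α, Q.coeff α = 0 ∨ IsUnit (Q.coeff α)) {p : MvPolynomial σ κ} (h : Q * p = 0) :
    p = 0 := by
  obtain ⟨_, _⟩ := exists_wellFoundedGT (α := σ)
  let m : MonomialOrder σ := MonomialOrder.lex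
  have hlc : m.leadingCoeff Q ∈ nonZeroDivisors κ := by
    rcases hu (m.degree Q) with h | h
    · exact absurd (m.leadingCoeff_eq_zero_iff.1 h) hQ
    · exact h.mem_nonZeroDivisors
  have h2 := MonomialOrder.leadingCoeff_mul_of_left_mem_nonZeroDivisors (g := p) hlc
  rw [h, MonomialOrder.leadingCoeff_zero] at h2
  have := (mem_nonZeroDivisors_iff.1 hlc).1 _ h2.symm
  exact m.leadingCoeff_eq_zero_iff.1 this

lemma dep_of_integral_coeff [Algebra k κ] {s : σ → κ} (hs : AlgebraicIndependent k s)
    {Q : MvPolynomial σ κ} (hreg : ∀ p, Q * p = 0 → p = 0) (hint : ∀ α, IsIntegral k (Q.coeff α))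
    (h0 : MvPolynomial.eval s Q = 0) (hQ : Nontrivial κ) : False := by
  have := (algebraMap k κ).domain_nontrivial
  have hQi : IsIntegral (MvPolynomial σ k) Q :=
    MvPolynomial.isIntegral_iff_isIntegral_coeff.2 hint
  obtain ⟨p, hp, hpe⟩ := hQi
  have main : ∀ (n : ℕ) (p : Polynomial (MvPolynomial σ k)), p.natDegree ≤ n → p ≠ 0 →
      p.eval₂ (algebraMap _ _) Q = 0 → False := by
    have c0 : ∀ p : Polynomial (MvPolynomial σ k),
        p.eval₂ (algebraMap _ (MvPolynomial σ κ)) Q = 0 → p.coeff 0 = 0 := by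
      intro p hp
      have h1 := congrArg (MvPolynomial.eval s) hp
      rw [Polynomial.hom_eval₂, h0, Polynomial.eval₂_at_zero, map_zero, RingHom.comp_apply,
        MvPolynomial.algebraMap_def, MvPolynomial.eval_map] at h1
      exact hs.eq_zero_of_aeval_eq_zero _ h1
    intro n
    induction n with
    | zero =>
      intro p hd hp he
      apply hp
      rw [Polynomial.eq_C_of_natDegree_le_zero hd, c0 p he, Polynomial.C_0]
    | succ n ih =>
      intro p hd hp he
      have h1 := c0 p he
      have h2 : p = Polynomial.divX p * Polynomial.X := by
        conv_lhs => rw [← Polynomial.divX_mul_X_add p, h1, Polynomial.C_0, add_zero]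
      refine ih p.divX (by rw [Polynomial.natDegree_divX_eq_natDegree_tsub_one]; omega) ?_ ?_
      · intro h; rw [h, zero_mul] at h2; exact hp h2
      · apply hreg
        rw [h2, Polynomial.eval₂_mul, Polynomial.eval₂_X] at he
        rw [mul_comm]; exact he
  exact main _ p le_rfl hp.ne_zero hpe

lemma integral_of_mem_adjoin_inv [Algebra k κ] {t u z : κ} (htu : t * u = 1)
    (hz : z ∈ Algebra.adjoin k {u}) (h : u * z = 1) : IsIntegral k t := by
  nontriviality κ
  have := (algebraMap k κ).domain_nontrivial
  have hzt : z = t := by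
    calc z = (t * u) * z := by rw [htu, one_mul]
      _ = t * (u * z) := by ring
      _ = t := by rw [h, mul_one]
  rw [hzt, Algebra.adjoin_singleton_eq_range_aeval] at hz
  obtain ⟨q, hq⟩ := hz
  let _ : Invertible u := ⟨t, htu, by rw [mul_comm]; exact htu⟩
  have h1 := Polynomial.eval₂_reverse_mul_pow (algebraMap k κ) u q
  have hinv : ⅟u = t := rfl
  have hq' : q.eval₂ (algebraMap k κ) u = t := hq
  rw [hinv, hq'] at h1
  refine ⟨Polynomial.X ^ (q.natDegree + 1) - q.reverse, ?_, ?_⟩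
  · refine Polynomial.monic_X_pow_sub (lt_of_le_of_lt (Polynomial.degree_le_natDegree (p := q.reverse)) ?_)
    exact_mod_cast Nat.lt_succ_of_le (Polynomial.reverse_natDegree_le q)
  · rw [Polynomial.eval₂_sub, Polynomial.eval₂_X_pow, sub_eq_zero]
    calc t ^ (q.natDegree + 1) = t ^ q.natDegree * t := pow_succ _ _
      _ = t ^ q.natDegree * (q.reverse.eval₂ (algebraMap k κ) t * u ^ q.natDegree) := by rw [h1]
      _ = (t * u) ^ q.natDegree * q.reverse.eval₂ (algebraMap k κ) t := by ring
      _ = _ := by rw [htu, one_pow, one_mul]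

end Comm

section Main

variable {G : Type u} [CommGroup G] {L : Type v} [CommRing L] {𝒜 : GradedStr G L}

/-- A homogeneous element satisfying a polynomial over a graded subring all of whose nonzero
homogeneous elements are units of `V` lies in `V`. -/
lemma mem_of_algebraic (hL : 𝒜.IsGradedField) {V A : Subring L} (hV : IsGVRofSubfield 𝒜 ⊤ V)
    (hA : 𝒜.IsGradedSubring A) (hAV : A ≤ V)
    (hAinv : ∀ s ∈ A, 𝒜.IsHomog s → s ≠ 0 → Ring.inverse s ∈ V)
    {x : L} (hx : 𝒜.IsHomog x) (hx0 : x ≠ 0) {p : Polynomial L} (hp0 : p ≠ 0)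
    (hpA : ∀ n, p.coeff n ∈ A) (hpx : p.eval x = 0) : x ∈ V := by
  by_contra hxV
  have hu := (hV.2.2 x trivial hx0 hx).resolve_left hxV
  have hxu := hL.mul_inv hx hx0
  set u := Ring.inverse x with hudef
  obtain ⟨g, hg⟩ := hx
  obtain ⟨n, hn⟩ : ∃ n, p.coeff n ≠ 0 := by
    by_contra h; push Not at h; exact hp0 (Polynomial.ext (by simpa using h))
  obtain ⟨h, hh⟩ : ∃ h, 𝒜.comp (p.coeff n) h ≠ 0 := by
    by_contra hc; push Not at hc; exact hn (𝒜.eq_zero_of_comp hc)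
  let h0 := g ^ n * h
  let c : ℕ → L := fun i => 𝒜.comp (p.coeff i) ((g ^ i)⁻¹ * h0)
  let q : Polynomial L := ∑ i ∈ Finset.range (p.natDegree + 1), Polynomial.C (c i) * Polynomial.X ^ i
  have hqc : ∀ i, q.coeff i = c i := by
    intro i
    simp only [q, Polynomial.finsetSum_coeff, Polynomial.coeff_C_mul, Polynomial.coeff_X_pow]
    simp only [mul_ite, mul_one, mul_zero, Finset.sum_ite_eq, Finset.mem_range]
    split_ifs with hi
    · rfl
    · simp only [c]
      rw [Polynomial.coeff_eq_zero_of_natDegree_lt (by omega), comp_zero']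
  have hq0 : q ≠ 0 := by
    intro e
    apply hh
    have := hqc n
    rw [e, Polynomial.coeff_zero] at this
    simpa [c, h0] using this.symm
  have hqx : q.eval x = 0 := by
    have h1 : 𝒜.comp (p.eval x) h0 = 0 := by rw [hpx, comp_zero']
    rw [Polynomial.eval_eq_sum_range, comp_sum'] at h1
    rw [← h1]
    simp only [q, Polynomial.eval_finsetSum, Polynomial.eval_mul, Polynomial.eval_C,
      Polynomial.eval_pow, Polynomial.eval_X]
    exact Finset.sum_congr rfl fun i _ => (𝒜.comp_mul_right (𝒜.pow_mem_deg hg i) _ _).symm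
  have hqA : ∀ i, q.coeff i ∈ A := fun i => by rw [hqc]; exact hA _ (hpA i) _
  have hlc : q.leadingCoeff ≠ 0 := Polynomial.leadingCoeff_ne_zero.2 hq0
  have hlch : 𝒜.IsHomog q.leadingCoeff := by
    rw [Polynomial.leadingCoeff, hqc]; exact 𝒜.comp_homog _ _
  have hci := hAinv _ (hqA _) hlch hlc
  have hcc := hL.mul_inv hlch hlc
  rw [Polynomial.eval_eq_sum_range, Finset.sum_range_succ] at hqx
  change _ + q.leadingCoeff * _ = 0 at hqx
  rcases hN : q.natDegree with _ | N
  · rw [hN] at hqx; simp at hqx; exact hlc (by simpa using hqx)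
  rw [hN] at hqx
  apply hxV
  set d := Ring.inverse q.leadingCoeff
  have e : x = -∑ i ∈ Finset.range (N + 1), d * q.coeff i * (x ^ i * u ^ N) := by
    have h1 : x ^ N * u ^ N = 1 := by rw [← mul_pow, hxu, one_pow]
    have h2 : ∑ i ∈ Finset.range (N + 1), d * q.coeff i * (x ^ i * u ^ N) =
        d * (∑ i ∈ Finset.range (N + 1), q.coeff i * x ^ i) * u ^ N := by
      rw [Finset.mul_sum, Finset.sum_mul]
      exact Finset.sum_congr rfl fun i _ => by ring
    rw [h2, eq_neg_of_add_eq_zero_left hqx]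
    calc x = (q.leadingCoeff * d) * (x ^ N * u ^ N) * x := by rw [hcc, h1]; ring
      _ = _ := by ring
  rw [e]
  refine neg_mem (sum_mem fun i hi => ?_)
  refine MulMemClass.mul_mem (MulMemClass.mul_mem hci (hAV (hqA i))) ?_
  have hi' : i ≤ N := by simpa [Nat.lt_succ_iff] using hi
  have : x ^ i * u ^ N = u ^ (N - i) := by
    have : u ^ N = u ^ i * u ^ (N - i) := by rw [← pow_add]; congr 1; omega
    rw [this, ← mul_assoc, ← mul_pow, hxu, one_pow, one_mul]
  rw [this]
  exact pow_mem hu _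

/-- domination implies equality -/
lemma le_of_dominates (hL : 𝒜.IsGradedField) {F O V : Subring L}
    (hO : IsGVRofSubfield 𝒜 F O) {I : Set L} (hI : nonU 𝒜 O ⊆ I)
    (hVg : 𝒜.IsGradedSubring V)
    (hV : (1 : L) ∉ Submodule.span V I) {x : L} (hxV : x ∈ V) (hxF : ∀ g, 𝒜.comp x g ∈ F) :
    x ∈ O := by
  refine 𝒜.mem_of_comp_mem O fun g => ?_
  by_contra hg
  have h0 : 𝒜.comp x g ≠ 0 := fun h => hg (by rw [h]; exact zero_mem _)
  have hh := 𝒜.comp_homog x g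
  have hinv := (hO.2.2 _ (hxF g) h0 hh).resolve_left hg
  have : Ring.inverse (𝒜.comp x g) ∈ nonU 𝒜 O :=
    ⟨hinv, hL.inv_homog hh h0, Or.inr (by rwa [hL.inv_inv hh h0])⟩
  apply hV
  rw [← hL.mul_inv hh h0]
  exact Submodule.smul_mem _ (⟨_, hVg x hxV g⟩ : V) (Submodule.subset_span (hI this))

theorem surj_of_gp (hL : 𝒜.IsGradedField) (l K k : Subring L)
    (hl : 𝒜.IsGradedSubfield l) (hK : 𝒜.IsGradedSubfield K)
    (hk : 𝒜.IsGradedSubfield k) (hkl : k ≤ l) (hkK : k ≤ K)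
    (hgp : ∀ S : Set L, (∀ x ∈ S, x ∈ l ∧ x ≠ 0 ∧ 𝒜.IsHomog x) →
        AlgIndepOver k (fun s : S => (s : L)) →
        AlgIndepOver K (fun s : S => (s : L)))
    (O' : Subring L) (hO' : IsGVRofSubfield 𝒜 K O') (hkO : k ≤ O') :
    ∃ O : Subring L, (IsGVRofSubfield 𝒜 ⊤ O ∧ l ≤ O) ∧ O ⊓ K = O' := by
  have hnt := hL.1
  obtain ⟨T, -, hT⟩ := exists_maximal_algebraicIndependent (R := k) (∅ : Set L)
    {x | x ∈ l ∧ x ≠ 0 ∧ 𝒜.IsHomog x} (Set.empty_subset _)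
    ((algebraicIndependent_empty_iff k L).2 Subtype.val_injective)
  obtain ⟨⟨hTi, hTl⟩, hTmax⟩ := hT
  have hTK : AlgIndepOver K (fun s : T => (s : L)) := hgp T hTl hTi
  let A : Subring L := (Algebra.adjoin k T).toSubring
  let R : Subring L := (Algebra.adjoin O' T).toSubring
  have hAg : 𝒜.IsGradedSubring A := by
    simp only [A]
    rw [Algebra.adjoin_eq_ring_closure]
    refine isGradedSubring_closure ?_
    rintro _ (⟨x, rfl⟩ | hx) g
    · exact Subring.subset_closure (Or.inl ⟨⟨_, hk.1 x x.2 g⟩, rfl⟩)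
    · exact comp_mem_of_homog (hTl hx).2.2 (Subring.subset_closure (Or.inr hx)) g
  have hRg : 𝒜.IsGradedSubring R := by
    simp only [R]
    rw [Algebra.adjoin_eq_ring_closure]
    refine isGradedSubring_closure ?_
    rintro _ (⟨x, rfl⟩ | hx) g
    · exact Subring.subset_closure (Or.inl ⟨⟨_, hO'.2.1 x x.2 g⟩, rfl⟩)
    · exact comp_mem_of_homog (hTl hx).2.2 (Subring.subset_closure (Or.inr hx)) g
  have hO'R : O' ≤ R := fun x hx => (Algebra.adjoin O' T).algebraMap_mem ⟨x, hx⟩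
  have hTR : T ⊆ R := Algebra.subset_adjoin
  have hAR : A ≤ R := by
    simp only [A]
    rw [Algebra.adjoin_eq_ring_closure, Subring.closure_le]
    rintro _ (⟨x, rfl⟩ | hx)
    · exact hO'R (hkO x.2)
    · exact hTR hx
  let M : Submonoid L :=
    { carrier := {s | s ∈ A ∧ 𝒜.IsHomog s ∧ s ≠ 0}
      one_mem' := ⟨OneMemClass.one_mem _, ⟨1, 𝒜.one_mem⟩, one_ne_zero⟩
      mul_mem' := fun {a b} ha hb => ⟨MulMemClass.mul_mem ha.1 hb.1, IsHomog.mul 𝒜 ha.2.1 hb.2.1,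
        hL.mul_ne ha.2.1 ha.2.2 hb.2.2⟩ }
  have hspan : ∀ y ∈ Submodule.span R (nonU 𝒜 O'), ∃ Q : MvPolynomial T O',
      Q ∈ Ideal.map MvPolynomial.C (mI hL hK hO') ∧ MvPolynomial.aeval (fun s : T => (s : L)) Q = y := by
    intro y hy
    induction hy using Submodule.span_induction with
    | mem y hy =>
      exact ⟨MvPolynomial.C ⟨y, hy.1⟩, Ideal.mem_map_of_mem _ (mem_mI_of_nonU hL hK hO' hy),
        by rw [MvPolynomial.aeval_C]; rfl⟩
    | zero => exact ⟨0, zero_mem _, map_zero _⟩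
    | add x y _ _ hx hy =>
      obtain ⟨P, hP, rfl⟩ := hx
      obtain ⟨Q, hQ, rfl⟩ := hy
      exact ⟨P + Q, add_mem hP hQ, map_add _ _ _⟩
    | smul r x _ hx =>
      obtain ⟨P, hP, rfl⟩ := hx
      obtain ⟨r, hr⟩ := r
      have hr' : r ∈ Algebra.adjoin O' T := hr
      rw [Algebra.adjoin_eq_range] at hr'
      obtain ⟨q, rfl⟩ := hr'
      exact ⟨q * P, Ideal.mul_mem_left _ _ hP, map_mul _ _ _⟩
  have hd : ∀ s ∈ M, s ∉ Submodule.span R (nonU 𝒜 O') := by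
    intro s hs hsp
    obtain ⟨Q, hQ, hQs⟩ := hspan s hsp
    have hsA : s ∈ Algebra.adjoin k T := hs.1
    rw [Algebra.adjoin_eq_range] at hsA
    obtain ⟨P, hP⟩ := hsA
    have hPs : MvPolynomial.aeval (fun s : T => (s : L)) P = s := hP
    have e : MvPolynomial.map (Subring.inclusion hkK) P
        = MvPolynomial.map (Subring.inclusion hO'.1) Q := by
      apply hTK
      simp only [MvPolynomial.coe_eval₂Hom, MvPolynomial.eval₂_map]
      exact hPs.trans hQs.symm
    apply hs.2.2
    have hP0 : P = 0 := by
      ext α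
      have h1 := congrArg (MvPolynomial.coeff α) e
      rw [MvPolynomial.coeff_map, MvPolynomial.coeff_map] at h1
      have h2 : ((P.coeff α : k) : L) = ((Q.coeff α : O') : L) := congrArg (Subtype.val) h1
      have h3 := MvPolynomial.mem_map_C_iff.1 hQ α
      have h4 := subfield_mI hL hK hO' hk hkO h3 (by rw [← h2]; exact (P.coeff α).2)
      rw [h2, h4]; simp
    rw [← hPs, hP0, map_zero]
  obtain ⟨V, hV, hRV, hVd, hVinv⟩ := chevalley hL (top_subfield (𝒜 := 𝒜)) hRg le_top
    (I := nonU 𝒜 O') (fun x hx => hO'R hx.1) (M := M) (fun s hs => hAR hs.1) hd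
  refine ⟨V, ⟨hV, ?_⟩, ?_⟩
  · -- l ≤ V
    intro x hx
    refine 𝒜.mem_of_comp_mem V fun g => ?_
    have hyl := hl.1 x hx g
    have hyh := 𝒜.comp_homog x g
    generalize 𝒜.comp x g = y at hyl hyh
    by_cases hy0 : y = 0
    · rw [hy0]; exact zero_mem _
    by_cases hyT : y ∈ T
    · exact hRV (hTR hyT)
    have halg : IsAlgebraic (Algebra.adjoin k T) y := by
      by_contra htr
      have hins : AlgebraicIndepOn k id (insert y T) :=
        AlgebraicIndepOn.insert hTi (by rw [Set.image_id]; exact htr)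
      exact hyT (hTmax ⟨hins, Set.insert_subset ⟨hyl, hy0, hyh⟩ hTl⟩ (Set.subset_insert _ _)
        (Set.mem_insert _ _))
    obtain ⟨p, hp0, hp⟩ := halg
    refine mem_of_algebraic hL hV hAg (hAR.trans hRV)
      (fun s hs hh h0 => hVinv s ⟨hs, hh, h0⟩ hh h0) hyh hy0
      (p := p.map (algebraMap (Algebra.adjoin k T) L)) ?_ ?_ ?_
    · rwa [Ne, Polynomial.map_eq_zero_iff Subtype.val_injective]
    · intro n; rw [Polynomial.coeff_map]; exact (p.coeff n).2
    · rw [Polynomial.eval_map]; exact hp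
  · apply le_antisymm
    · rintro x ⟨hxV, hxK⟩
      exact le_of_dominates hL hO' subset_rfl hV.2.1 (hVd 1 (OneMemClass.one_mem _)) hxV
        (fun g => hK.1 x hxK g)
    · exact fun x hx => ⟨hRV (hO'R hx), hO'.1 hx⟩

lemma exists_minimal_gvr {K k : Subring L} (hK : 𝒜.IsGradedSubfield K) (hkK : k ≤ K) :
    ∃ O : Subring L, IsGVRofSubfield 𝒜 K O ∧ k ≤ O ∧
      ∀ V, IsGVRofSubfield 𝒜 K V → k ≤ V → V ≤ O → O ≤ V := by
  obtain ⟨O, -, hO⟩ := zorn_le_nonempty₀ (α := (Subring L)ᵒᵈ)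
    {O | IsGVRofSubfield 𝒜 K (OrderDual.ofDual O) ∧ k ≤ OrderDual.ofDual O}
    (by
      intro c hcs hc W hW
      let d : Set (Subring L) := OrderDual.toDual ⁻¹' c
      have hd : ∀ O ∈ d, IsGVRofSubfield 𝒜 K O ∧ k ≤ O := fun O hO => hcs hO
      have hWd : OrderDual.ofDual W ∈ d := hW
      refine ⟨OrderDual.toDual (sInf d), ⟨⟨?_, ?_, ?_⟩, ?_⟩, fun z hz => ?_⟩
      · exact (sInf_le hWd).trans (hd _ hWd).1.1
      · intro x hx g
        rw [OrderDual.ofDual_toDual, Subring.mem_sInf] at hx ⊢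
        exact fun O hO => (hd O hO).1.2.1 x (hx O hO) g
      · intro f hf h0 hh
        rw [OrderDual.ofDual_toDual, Subring.mem_sInf, Subring.mem_sInf]
        by_contra hcon
        push Not at hcon
        obtain ⟨⟨O₁, h1, h1'⟩, ⟨O₂, h2, h2'⟩⟩ := hcon
        have t1 := ((hd _ h1).1.2.2 f hf h0 hh).resolve_left h1'
        have t2 := ((hd _ h2).1.2.2 f hf h0 hh).resolve_right h2'
        have htot : O₂ ≤ O₁ ∨ O₁ ≤ O₂ :=
          hc.total (x := OrderDual.toDual O₁) (y := OrderDual.toDual O₂) h1 h2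
        rcases htot with h | h
        · exact h1' (h t2)
        · exact h2' (h t1)
      · exact le_sInf fun O hO => (hd O hO).2
      · exact sInf_le (α := Subring L) (s := d) (a := OrderDual.ofDual z) hz)
    (OrderDual.toDual K) ⟨⟨le_rfl, hK.1, fun f hf _ _ => Or.inl hf⟩, hkK⟩
  exact ⟨OrderDual.ofDual O, hO.1.1, hO.1.2, fun V hV hkV hVO => hO.2 (y := OrderDual.toDual V)
    ⟨hV, hkV⟩ hVO⟩

/-- For minimal `O`, residues of homogeneous elements are integral over `k`. -/
lemma residue_integral (hL : 𝒜.IsGradedField) {K k O : Subring L} (hK : 𝒜.IsGradedSubfield K)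
    (hk : 𝒜.IsGradedSubfield k)
    (hO : IsGVRofSubfield 𝒜 K O) (hkO : k ≤ O)
    (hmin : ∀ V, IsGVRofSubfield 𝒜 K V → k ≤ V → V ≤ O → O ≤ V)
    {κ : Type*} [CommRing κ] (φ : O →+* κ) (hφ : ∀ x : O, (x : L) ∈ nonU 𝒜 O → φ x = 0)
    (t : O) (ht : 𝒜.IsHomog (t : L)) :
    (φ.comp (Subring.inclusion hkO)).IsIntegralElem (φ t) := by
  let _ : Algebra k κ := (φ.comp (Subring.inclusion hkO)).toAlgebra
  change IsIntegral k (φ t)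
  by_cases htN : (t : L) ∈ nonU 𝒜 O
  · rw [hφ t htN]; exact isIntegral_zero
  have ht0 : (t : L) ≠ 0 := fun h => htN (by rw [h]; exact nonU_zero O)
  have huO : Ring.inverse (t : L) ∈ O := by
    by_contra h; exact htN ⟨t.2, ht, Or.inr h⟩
  let u : O := ⟨Ring.inverse (t : L), huO⟩
  have htu : t * u = 1 := Subtype.ext (hL.mul_inv ht ht0)
  have huh : 𝒜.IsHomog (u : L) := hL.inv_homog ht ht0
  let X : Set L := (↑k ∪ nonU 𝒜 O) ∪ {(u : L)}
  let R : Subring L := Subring.closure X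
  let I : Set L := nonU 𝒜 O ∪ {(u : L)}
  have hIR : I ⊆ R := by
    rintro x (hx | hx)
    · exact Subring.subset_closure (Or.inl (Or.inr hx))
    · exact Subring.subset_closure (Or.inr hx)
  have hkR : k ≤ R := fun x hx => Subring.subset_closure (Or.inl (Or.inl hx))
  have hRg : 𝒜.IsGradedSubring R := by
    refine isGradedSubring_closure ?_
    rintro x ((hx | hx) | hx) g
    · exact hkR (hk.1 x hx g)
    · exact comp_mem_of_homog hx.2.1 (hIR (Or.inl hx)) g
    · obtain rfl : x = u := hx
      exact comp_mem_of_homog huh (hIR (Or.inr rfl)) g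
  have hRO : R ≤ O := by
    refine Subring.closure_le.2 ?_
    rintro x ((hx | hx) | hx)
    · exact hkO hx
    · exact hx.1
    · obtain rfl : x = u := hx
      exact u.2
  have h1 : (1 : L) ∈ Submodule.span R I := by
    by_contra hcon
    obtain ⟨V, hV, hRV, hVd, -⟩ := chevalley hL hK hRg (hRO.trans hO.1) hIR
      (M := ⊥) (fun s hs => by rw [Submonoid.mem_bot.1 hs]; exact OneMemClass.one_mem _)
      (fun s hs => by rw [Submonoid.mem_bot.1 hs]; exact hcon)
    have hV1 := hVd 1 (OneMemClass.one_mem _)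
    have hVO : V ≤ O := fun x hx => le_of_dominates hL hO Set.subset_union_left hV.2.1 hV1 hx
      (fun g => hV.1 (hV.2.1 x hx g))
    have hOV := hmin V hV (hkR.trans hRV) hVO
    apply hV1
    have : (1 : L) = (t : L) * u := (hL.mul_inv ht ht0).symm
    rw [this]
    exact Submodule.smul_mem _ (⟨t, hOV t.2⟩ : V) (Submodule.subset_span (Or.inr rfl))
  have hRφ : ∀ y, y ∈ R → ∃ hy : y ∈ O, φ ⟨y, hy⟩ ∈ Algebra.adjoin k {φ u} := by
    intro y hy
    let W : Subring L := ((Algebra.adjoin k {φ u}).toSubring.comap φ).map O.subtype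
    have hRW : R ≤ W := by
      refine Subring.closure_le.2 ?_
      rintro x ((hx | hx) | hx)
      · exact ⟨⟨x, hkO hx⟩, (Algebra.adjoin k {φ u}).algebraMap_mem ⟨x, hx⟩, rfl⟩
      · refine ⟨⟨x, hx.1⟩, ?_, rfl⟩
        change φ _ ∈ Algebra.adjoin k {φ u}
        rw [hφ ⟨x, hx.1⟩ hx]; exact zero_mem _
      · obtain rfl : x = u := hx
        exact ⟨u, Algebra.subset_adjoin rfl, rfl⟩
    obtain ⟨z, hz, rfl⟩ := hRW hy
    exact ⟨z.2, hz⟩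
  have hsp : ∀ y ∈ Submodule.span R I, ∃ hy : y ∈ O, ∃ z ∈ Algebra.adjoin k {φ u},
      φ ⟨y, hy⟩ = φ u * z := by
    intro y hy
    induction hy using Submodule.span_induction with
    | mem y hy =>
      refine ⟨hRO (hIR hy), ?_⟩
      rcases hy with hy | hy
      · exact ⟨0, zero_mem _, by rw [hφ _ hy, mul_zero]⟩
      · obtain rfl : y = u := hy
        exact ⟨1, OneMemClass.one_mem _, by rw [mul_one]⟩
    | zero => exact ⟨zero_mem _, 0, zero_mem _, by rw [mul_zero]; exact map_zero φ⟩
    | add x y _ _ hx hy =>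
      obtain ⟨hx, a, ha, ea⟩ := hx
      obtain ⟨hy, b, hb, eb⟩ := hy
      refine ⟨add_mem hx hy, a + b, add_mem ha hb, ?_⟩
      rw [mul_add, ← ea, ← eb, ← map_add]; rfl
    | smul r x _ hx =>
      obtain ⟨hx, a, ha, ea⟩ := hx
      obtain ⟨hr, hr'⟩ := hRφ r r.2
      refine ⟨MulMemClass.mul_mem hr hx, _, MulMemClass.mul_mem hr' ha, ?_⟩
      rw [mul_left_comm, ← ea, ← map_mul]; rfl
  obtain ⟨h1O, z, hz, e⟩ := hsp 1 h1
  refine integral_of_mem_adjoin_inv (u := φ u) (z := z) (by rw [← map_mul, htu, map_one]) hz ?_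
  rw [← e]; exact map_one φ

/-- A finite set of nonzero homogeneous elements has one that divides all the others. -/
lemma exists_max (hL : 𝒜.IsGradedField) {K O : Subring L} (hK : 𝒜.IsGradedSubfield K)
    (hO : IsGVRofSubfield 𝒜 K O) {ι : Type*} (s : Finset ι) (a : ι → L) (haK : ∀ i, a i ∈ K)
    (hah : ∀ i, 𝒜.IsHomog (a i)) (h0 : ∃ i ∈ s, a i ≠ 0) :
    ∃ j ∈ s, a j ≠ 0 ∧ ∀ i ∈ s, a i * Ring.inverse (a j) ∈ O := by
  classical
  induction s using Finset.induction_on with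
  | empty => simp at h0
  | insert i s hi ih =>
    by_cases hs : ∃ i ∈ s, a i ≠ 0
    · obtain ⟨j, hj, hj0, hjm⟩ := ih hs
      have hjj := hL.mul_inv (hah j) hj0
      by_cases hij : a i * Ring.inverse (a j) ∈ O
      · refine ⟨j, Finset.mem_insert_of_mem hj, hj0, ?_⟩
        intro i' hi'
        rcases Finset.mem_insert.1 hi' with rfl | h
        exacts [hij, hjm _ h]
      · have hi0 : a i ≠ 0 := by
          intro h; rw [h, zero_mul] at hij; exact hij (zero_mem _)
        have hii := hL.mul_inv (hah i) hi0
        have h2 := (hO.2.2 _ (MulMemClass.mul_mem (haK i) (hK.2 _ (haK j) (hah j) hj0))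
          (hL.mul_ne (hah i) hi0 (hL.inv_ne (hah j) hj0))
          (IsHomog.mul 𝒜 (hah i) (hL.inv_homog (hah j) hj0))).resolve_left hij
        have e : (a i * Ring.inverse (a j)) * (a j * Ring.inverse (a i)) = 1 := by
          calc _ = (a i * Ring.inverse (a i)) * (a j * Ring.inverse (a j)) := by ring
            _ = 1 := by rw [hii, hjj, one_mul]
        rw [inverse_eq e] at h2
        refine ⟨i, Finset.mem_insert_self _ _, hi0, ?_⟩
        intro i' hi'
        rcases Finset.mem_insert.1 hi' with rfl | h
        · rw [hii]; exact OneMemClass.one_mem _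
        · have : a i' * Ring.inverse (a i) =
              (a i' * Ring.inverse (a j)) * (a j * Ring.inverse (a i)) := by
            calc _ = a i' * Ring.inverse (a i) * (a j * Ring.inverse (a j)) := by rw [hjj, mul_one]
              _ = _ := by ring
          rw [this]
          exact MulMemClass.mul_mem (hjm _ h) h2
    · push Not at hs
      obtain ⟨j, hj, hj0⟩ := h0
      rcases Finset.mem_insert.1 hj with rfl | h
      · refine ⟨j, hj, hj0, ?_⟩
        intro i' hi'
        rcases Finset.mem_insert.1 hi' with rfl | h
        · rw [hL.mul_inv (hah _) hj0]; exact OneMemClass.one_mem _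
        · rw [hs _ h, zero_mul]; exact zero_mem _
      · exact absurd (hs j h) hj0

lemma monomial_homog {S : Set L} (hS : ∀ x ∈ S, 𝒜.IsHomog x) (α : S →₀ ℕ) :
    𝒜.IsHomog (α.prod fun i n => (i : L) ^ n) := by
  unfold Finsupp.prod
  refine Finset.prod_induction _ (fun x => 𝒜.IsHomog x) (fun a b => IsHomog.mul 𝒜)
    ⟨1, 𝒜.one_mem⟩ ?_
  intro i _
  obtain ⟨g, hg⟩ := hS i i.2
  exact ⟨_, 𝒜.pow_mem_deg hg _⟩

theorem gp_of_surj (hL : 𝒜.IsGradedField) (l K k : Subring L)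
    (hl : 𝒜.IsGradedSubfield l) (hK : 𝒜.IsGradedSubfield K)
    (hk : 𝒜.IsGradedSubfield k) (hkl : k ≤ l) (hkK : k ≤ K)
    (hsurj : ∀ O' : Subring L, IsGVRofSubfield 𝒜 K O' → k ≤ O' →
      ∃ O : Subring L, (IsGVRofSubfield 𝒜 ⊤ O ∧ l ≤ O) ∧ O ⊓ K = O')
    (S : Set L) (hS : ∀ x ∈ S, x ∈ l ∧ x ≠ 0 ∧ 𝒜.IsHomog x)
    (hSk : AlgIndepOver k (fun s : S => (s : L))) :
    AlgIndepOver K (fun s : S => (s : L)) := by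
  obtain ⟨O₀, hO₀, hkO₀, hmin⟩ := exists_minimal_gvr hK hkK
  obtain ⟨O, ⟨hO, hlO⟩, hOK⟩ := hsurj O₀ hO₀ hkO₀
  have hO₀O : O₀ ≤ O := by rw [← hOK]; exact inf_le_left
  have hkO : k ≤ O := hkl.trans hlO
  let m := mI hL (top_subfield (𝒜 := 𝒜)) hO
  let φ : O →+* (O ⧸ m) := Ideal.Quotient.mk m
  have hφ0 : ∀ x : O, φ x = 0 ↔ x ∈ m := fun x => Ideal.Quotient.eq_zero_iff_mem
  have hntκ : Nontrivial (O ⧸ m) := by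
    refine ⟨1, 0, fun h => one_notMem_mI hL (top_subfield (𝒜 := 𝒜)) hO ?_⟩
    rw [← map_one φ, hφ0] at h; exact h
  let _ : Algebra k (O ⧸ m) := (φ.comp (Subring.inclusion hkO)).toAlgebra
  let s' : S → O := fun x => ⟨x, hlO (hS x x.2).1⟩
  let s : S → O ⧸ m := fun x => φ (s' x)
  have hind : AlgebraicIndependent k s := by
    rw [algebraicIndependent_iff_injective_aeval, injective_iff_map_eq_zero]
    intro P hP
    have e1 : MvPolynomial.aeval s P
        = φ (MvPolynomial.eval₂ (Subring.inclusion hkO) s' P) := by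
      rw [MvPolynomial.hom_eval₂]; rfl
    rw [e1, hφ0] at hP
    have e2 : ((MvPolynomial.eval₂ (Subring.inclusion hkO) s' P : O) : L)
        = MvPolynomial.eval₂ k.subtype (fun x : S => (x : L)) P := by
      have := MvPolynomial.hom_eval₂ P (Subring.inclusion hkO) O.subtype s'
      exact this
    have h3 := subfield_mI hL _ hO hl hlO hP (by
      rw [e2, MvPolynomial.eval₂_eq]
      refine sum_mem fun d _ => MulMemClass.mul_mem (hkl (P.coeff d).2) ?_
      exact prod_mem fun i _ => pow_mem (hS i i.2).1 _)
    rw [e2] at h3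
    exact hSk (h3.trans (map_zero (MvPolynomial.eval₂Hom k.subtype _)).symm)
  unfold AlgIndepOver
  rw [injective_iff_map_eq_zero]
  intro P hP
  by_contra hP0
  have hP' : ∑ d ∈ P.support, ((P.coeff d : K) : L) * (d.prod fun i n => (i : L) ^ n) = 0 := hP
  choose w hw using monomial_homog (𝒜 := 𝒜) (fun x hx => (hS x hx).2.2)
  obtain ⟨α₁, hα₁⟩ := MvPolynomial.ne_zero_iff.1 hP0
  obtain ⟨g, hg⟩ : ∃ h, 𝒜.comp ((P.coeff α₁ : K) : L) h ≠ 0 := by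
    by_contra hc; push Not at hc
    exact hα₁ (Subtype.ext (𝒜.eq_zero_of_comp hc))
  let h0 := w α₁ * g
  let a : (S →₀ ℕ) → L := fun d => 𝒜.comp ((P.coeff d : K) : L) ((w d)⁻¹ * h0)
  have haK : ∀ d, a d ∈ K := fun d => hK.1 _ (P.coeff d).2 _
  have hah : ∀ d, 𝒜.IsHomog (a d) := fun d => 𝒜.comp_homog _ _
  have hasum : ∑ d ∈ P.support, a d * (d.prod fun i n => (i : L) ^ n) = 0 := by
    have := congrArg (fun z => 𝒜.comp z h0) hP'
    simp only [comp_sum', comp_zero'] at this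
    rw [← this]
    exact Finset.sum_congr rfl fun d _ => (𝒜.comp_mul_right (hw d) _ _).symm
  obtain ⟨j, hj, hj0, hjm⟩ := exists_max hL hK hO₀ P.support a haK hah
    ⟨α₁, MvPolynomial.mem_support_iff.2 hα₁, by simpa [a, h0] using hg⟩
  let b := Ring.inverse (a j)
  have hbh : 𝒜.IsHomog b := hL.inv_homog (hah j) hj0
  -- scaled coefficients
  have he : ∀ d, ∃ e : O₀, (d ∈ P.support → (e : L) = a d * b) ∧ (d ∉ P.support → e = 0) ∧
      𝒜.IsHomog (e : L) := by
    intro d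
    by_cases hd : d ∈ P.support
    · exact ⟨⟨_, hjm d hd⟩, fun _ => rfl, fun h => absurd hd h, IsHomog.mul 𝒜 (hah d) hbh⟩
    · exact ⟨0, fun h => absurd h hd, fun _ => rfl, ⟨1, zero_mem _⟩⟩
  choose e he1 he2 heh using he
  let ψ : O₀ →+* (O ⧸ m) := φ.comp (Subring.inclusion hO₀O)
  have hψ : ∀ x : O₀, (x : L) ∈ nonU 𝒜 O₀ → ψ x = 0 := by
    intro x hx
    refine (hφ0 _).2 (mem_mI_of_nonU hL _ hO ⟨hO₀O x.2, hx.2.1, ?_⟩)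
    rcases hx.2.2 with h | h
    · exact Or.inl h
    · by_cases hx0 : (x : L) = 0
      · exact Or.inl hx0
      · refine Or.inr fun hinv => h ?_
        exact hOK.le ⟨hinv, hK.2 _ (hO₀.1 x.2) hx.2.1 hx0⟩
  let Q : MvPolynomial S (O ⧸ m) := ∑ d ∈ P.support, MvPolynomial.monomial d (ψ (e d))
  have hQc : ∀ d, Q.coeff d = ψ (e d) := by
    classical
    intro d
    simp only [Q, MvPolynomial.coeff_sum, MvPolynomial.coeff_monomial]
    rw [Finset.sum_ite_eq']
    split_ifs with h
    · rfl
    · rw [he2 d h, map_zero]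
  have hej : e j = 1 := Subtype.ext ((he1 j hj).trans (hL.mul_inv (hah j) hj0))
  have hQ0 : Q ≠ 0 := by
    intro h
    have := hQc j
    rw [h, hej, map_one, MvPolynomial.coeff_zero] at this
    exact zero_ne_one this
  have hQu : ∀ d, Q.coeff d = 0 ∨ IsUnit (Q.coeff d) := by
    intro d
    rw [hQc]
    by_cases hN : (e d : L) ∈ nonU 𝒜 O₀
    · exact Or.inl (hψ _ hN)
    · right
      have h0 : (e d : L) ≠ 0 := fun h => hN (by rw [h]; exact nonU_zero _)
      have hi : Ring.inverse (e d : L) ∈ O₀ := by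
        by_contra h; exact hN ⟨(e d).2, heh d, Or.inr h⟩
      have : IsUnit (e d) := IsUnit.of_mul_eq_one ⟨_, hi⟩ (Subtype.ext (hL.mul_inv (heh d) h0))
      exact this.map ψ
  refine dep_of_integral_coeff hind (Q := Q) (fun p hp => regular_of_units hQ0 hQu hp) ?_ ?_ hntκ
  · intro d
    rw [hQc]
    exact residue_integral hL hK hk hO₀ hkO₀ hmin ψ hψ (e d) (heh d)
  · simp only [Q, map_sum, MvPolynomial.eval_monomial]
    have hz : ∑ d ∈ P.support, (Subring.inclusion hO₀O (e d)) * (d.prod fun i n => s' i ^ n) = 0 := by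
      apply Subtype.ext
      have : O.subtype (∑ d ∈ P.support,
          (Subring.inclusion hO₀O (e d)) * (d.prod fun i n => s' i ^ n)) = 0 := by
        rw [map_sum]
        have h2 : ∑ d ∈ P.support, b * (a d * (d.prod fun i n => (i : L) ^ n)) = 0 := by
          rw [← Finset.mul_sum, hasum, mul_zero]
        rw [← h2]
        refine Finset.sum_congr rfl fun d hd => ?_
        rw [map_mul, Finsupp.prod, map_prod]
        have : O.subtype (Subring.inclusion hO₀O (e d)) = a d * b := he1 d hd
        rw [this, Finsupp.prod]
        have h3 : ∀ i ∈ d.support, O.subtype (s' i ^ d i) = (i : L) ^ d i := fun i _ => rfl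
        rw [Finset.prod_congr rfl h3]
        ring
      exact this
    have := congrArg φ hz
    rw [map_sum, map_zero] at this
    rw [← this]
    refine Finset.sum_congr rfl fun d _ => ?_
    rw [map_mul, Finsupp.prod, Finsupp.prod, map_prod]
    simp only [map_pow]
    rfl

end Main

/-- Let `L` be a `G`-graded field with graded subfields `l` and `K`,
and `k` a graded subfield with `k ⊆ l ∩ K`.  The restriction map
`ψ : P_{L/l} → P_{K/k}`, `O ↦ O ∩ K`, is surjective if and only if `l` and `K` are in
general position with respect to `k`: every family of homogeneous elements of `l^×`
algebraically independent over `k` is algebraically independent over `K`. -/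
theorem psi_surjective_iff_general_position
    {G : Type u} [CommGroup G] {L : Type v} [CommRing L]
    (𝒜 : GradedStr G L) (hL : 𝒜.IsGradedField)
    (l K k : Subring L)
    (hl : 𝒜.IsGradedSubfield l) (hK : 𝒜.IsGradedSubfield K)
    (hk : 𝒜.IsGradedSubfield k) (hkl : k ≤ l) (hkK : k ≤ K) :
    (∀ O' : Subring L, IsGVRofSubfield 𝒜 K O' → k ≤ O' →
      ∃ O : Subring L, (IsGVRofSubfield 𝒜 ⊤ O ∧ l ≤ O) ∧ O ⊓ K = O')
    ↔ ∀ S : Set L, (∀ x ∈ S, x ∈ l ∧ x ≠ 0 ∧ 𝒜.IsHomog x) →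
        AlgIndepOver k (fun s : S => (s : L)) →
        AlgIndepOver K (fun s : S => (s : L)) := by
  exact ⟨fun h S hS hSk => gp_of_surj hL l K k hl hK hk hkl hkK h S hS hSk,
    fun h O' hO' hkO => surj_of_gp hL l K k hl hK hk hkl hkK h O' hO' hkO⟩
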